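/- arXiv:1408.6183 — 4 statements merged into one kernel-verified Lean document; each statement's English description precedes it below -/
import Mathlib

section
/- Let λ be a partition with |λ| = k. Then for all natural numbers n, the number of oscillating tableaux of shape λ and length k+2n equals binom(2n+k, k) · (2n-1)!! · f^λ, where f^λ is the number of standard Young tableaux of shape λ. -/
/-- `ν` covers `μ` in Young's lattice: the Young diagram of `ν` is obtained from that of `μ`
by adding one box. -/
def YCov (μ ν : YoungDiagram) : Prop := μ ≤ ν ∧ ν.card = μ.card + 1

/-- `T` is an oscillating tableau of shape `lam` and length `l`: a sequence
`(λ⁰, λ¹, …, λˡ)` of partitions with `λ⁰ = ∅`, `λˡ = lam`, and consecutive terms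
differing by adding or removing a single box. -/
def IsOscTab (lam : YoungDiagram) (l : ℕ) (T : Fin (l + 1) → YoungDiagram) : Prop :=
  T 0 = ⊥ ∧ T (Fin.last l) = lam ∧
    ∀ i : Fin l, YCov (T i.castSucc) (T i.succ) ∨ YCov (T i.succ) (T i.castSucc)

/-- The set `OT(lam, l)` of oscillating tableaux of shape `lam` and length `l`. -/
def OscTab (lam : YoungDiagram) (l : ℕ) := {T : Fin (l + 1) → YoungDiagram // IsOscTab lam l T}

/-- `f^μ`: the number of standard Young tableaux of shape `μ`, i.e. bijective fillings of the
cells of `μ` with `0, 1, …, |μ| - 1` increasing along each row and down each column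
(a cell is a pair `(i, j)` = (row, column)). -/
noncomputable def sytCount (μ : YoungDiagram) : ℕ :=
  Nat.card {f : μ.cells → Fin μ.card //
    Function.Bijective f ∧
    (∀ a b : μ.cells, (a : ℕ × ℕ).1 = (b : ℕ × ℕ).1 → (a : ℕ × ℕ).2 < (b : ℕ × ℕ).2 → f a < f b) ∧
    (∀ a b : μ.cells, (a : ℕ × ℕ).2 = (b : ℕ × ℕ).2 → (a : ℕ × ℕ).1 < (b : ℕ × ℕ).1 → f a < f b)}

open Finset

namespace YoungDiagram

theorem eq_of_le_of_card_le {μ ν : YoungDiagram} (h : μ ≤ ν) (hc : ν.card ≤ μ.card) : μ = ν :=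
  YoungDiagram.ext (Finset.eq_of_subset_of_card_le (cells_subset_iff.2 h) hc)

theorem card_sup_add_card_inf (μ ν : YoungDiagram) :
    (μ ⊔ ν).card + (μ ⊓ ν).card = μ.card + ν.card :=
  Finset.card_union_add_card_inter μ.cells ν.cells

theorem card_bot : (⊥ : YoungDiagram).card = 0 := by
  simp [YoungDiagram.card]

theorem eq_bot_of_card_eq_zero {μ : YoungDiagram} (h : μ.card = 0) : μ = ⊥ :=
  (eq_of_le_of_card_le bot_le (by omega)).symm

end YoungDiagram

theorem yCov_iff_exists_insert {μ ν : YoungDiagram} :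
    YCov μ ν ↔ ∃ c, c ∉ μ ∧ ν.cells = insert c μ.cells := by
  constructor
  · rintro ⟨h, hc⟩
    have hsub := YoungDiagram.cells_subset_iff.2 h
    have h1 : (ν.cells \ μ.cells).card = 1 := by
      rw [Finset.card_sdiff_of_subset hsub]
      change ν.card - μ.card = 1
      omega
    obtain ⟨c, hc⟩ := Finset.card_eq_one.1 h1
    have hmem : c ∈ ν.cells \ μ.cells := by simp [hc]
    refine ⟨c, by simpa using (Finset.mem_sdiff.1 hmem).2, ?_⟩
    rw [← Finset.sdiff_union_of_subset hsub, hc]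
    rfl
  · rintro ⟨c, hc, h⟩
    refine ⟨YoungDiagram.cells_subset_iff.1 (h ▸ Finset.subset_insert _ _), ?_⟩
    change ν.cells.card = μ.cells.card + 1
    rw [h, Finset.card_insert_of_notMem (by simpa using hc)]

namespace YoungDiagram

/-- The rows of `μ` whose last box can be removed. -/
def removableRows (μ : YoungDiagram) : Finset ℕ :=
  (range (μ.colLen 0)).filter fun i => μ.rowLen (i + 1) < μ.rowLen i

theorem mem_removableRows {μ : YoungDiagram} {i : ℕ} :
    i ∈ μ.removableRows ↔ μ.rowLen (i + 1) < μ.rowLen i := by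
  simp only [removableRows, Finset.mem_filter, Finset.mem_range, and_iff_right_iff_imp]
  intro h
  rw [← mem_iff_lt_colLen, mem_iff_lt_rowLen]
  omega

/-- The rows of `μ` to which a box can be added. -/
def addableRows (μ : YoungDiagram) : Finset ℕ :=
  insert 0 (μ.removableRows.image Nat.succ)

theorem card_addableRows (μ : YoungDiagram) :
    μ.addableRows.card = μ.removableRows.card + 1 := by
  rw [addableRows, Finset.card_insert_of_notMem (by simp),
    Finset.card_image_of_injective _ Nat.succ_injective]

theorem succ_mem_addableRows {μ : YoungDiagram} {i : ℕ} :
    i + 1 ∈ μ.addableRows ↔ μ.rowLen (i + 1) < μ.rowLen i := by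
  simp [addableRows, mem_removableRows]

end YoungDiagram

open YoungDiagram

theorem exists_yCov_of_isLowerSet {μ : YoungDiagram} {s : Finset (ℕ × ℕ)}
    (hs : IsLowerSet (s : Set (ℕ × ℕ))) {c : ℕ × ℕ} (hc : c ∉ μ) (h : s = insert c μ.cells) :
    ∃ ν, YCov μ ν ∧ ν.cells = s :=
  ⟨⟨s, hs⟩, yCov_iff_exists_insert.2 ⟨c, hc, h⟩, rfl⟩

theorem image_cells_setOf_yCov (μ : YoungDiagram) :
    YoungDiagram.cells '' {ν | YCov μ ν} =
      ((μ.addableRows.image fun i => insert (i, μ.rowLen i) μ.cells : Finset _) : Set _) := by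
  ext s
  simp only [Set.mem_image, Set.mem_ofPred_eq, Finset.coe_image, Finset.mem_coe]
  constructor
  · rintro ⟨ν, h, rfl⟩
    obtain ⟨⟨i, j⟩, hc, h⟩ := yCov_iff_exists_insert.1 h
    have hν : ∀ d, d ∈ ν ↔ d = (i, j) ∨ d ∈ μ := fun d => by
      rw [← mem_cells, h]; simp
    have hcν : (i, j) ∈ ν := by simp [hν]
    have hj : j = μ.rowLen i := by
      by_contra hne
      rw [mem_iff_lt_rowLen] at hc
      have h1 : (i, μ.rowLen i) ∈ ν := ν.up_left_mem le_rfl (by omega) hcν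
      rw [hν, mem_iff_lt_rowLen, Prod.mk.injEq] at h1
      omega
    subst hj
    refine ⟨i, ?_, h.symm⟩
    cases i with
    | zero => simp [addableRows]
    | succ i =>
      rw [succ_mem_addableRows]
      have h1 : (i, μ.rowLen (i + 1)) ∈ ν := ν.up_left_mem (by omega) le_rfl hcν
      rw [hν, mem_iff_lt_rowLen, Prod.mk.injEq] at h1
      omega
  · rintro ⟨i, hi, rfl⟩
    refine exists_yCov_of_isLowerSet ?_ (c := (i, μ.rowLen i)) (by simp [mem_iff_lt_rowLen]) rfl
    rintro ⟨a, b⟩ ⟨a', b'⟩ hle hab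
    obtain ⟨h1, h2⟩ := Prod.mk_le_mk.1 hle
    simp only [Finset.coe_insert, Set.mem_insert_iff, Finset.mem_coe, mem_cells,
      Prod.mk.injEq, mem_iff_lt_rowLen] at hab ⊢
    rcases hab with ⟨rfl, rfl⟩ | hab
    · rcases h1.eq_or_lt with rfl | h1
      · omega
      · right
        cases a with
        | zero => omega
        | succ a =>
          rw [succ_mem_addableRows] at hi
          have := μ.rowLen_anti a' a (by omega)
          omega
    · have := μ.rowLen_anti a' a h1
      omega

theorem image_cells_setOf_yCov_right (ν : YoungDiagram) :
    YoungDiagram.cells '' {μ | YCov μ ν} =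
      ((ν.removableRows.image fun i => ν.cells.erase (i, ν.rowLen i - 1) : Finset _) :
        Set _) := by
  ext s
  simp only [Set.mem_image, Set.mem_ofPred_eq, Finset.coe_image, Finset.mem_coe]
  constructor
  · rintro ⟨μ, h, rfl⟩
    obtain ⟨⟨i, j⟩, hc, h⟩ := yCov_iff_exists_insert.1 h
    have hν : ∀ d, d ∈ ν ↔ d = (i, j) ∨ d ∈ μ := fun d => by
      rw [← mem_cells, h]; simp
    have hcν : j < ν.rowLen i := by rw [← mem_iff_lt_rowLen, hν]; simp
    have hj : ¬ j + 1 < ν.rowLen i := fun hlt => by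
      rw [← mem_iff_lt_rowLen, hν, Prod.mk.injEq] at hlt
      exact hc (μ.up_left_mem le_rfl (Nat.le_succ j) (hlt.resolve_left (by omega)))
    have hi : ¬ j < ν.rowLen (i + 1) := fun hlt => by
      rw [← mem_iff_lt_rowLen, hν, Prod.mk.injEq] at hlt
      exact hc (μ.up_left_mem (Nat.le_succ i) le_rfl (hlt.resolve_left (by omega)))
    refine ⟨i, mem_removableRows.2 (by omega), ?_⟩
    rw [h, show ν.rowLen i - 1 = j by omega, Finset.erase_insert (by simpa using hc)]
  · rintro ⟨i, hi, rfl⟩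
    rw [mem_removableRows] at hi
    have hmem : (i, ν.rowLen i - 1) ∈ ν.cells := by
      rw [mem_cells, mem_iff_lt_rowLen]; omega
    have hlow : IsLowerSet (ν.cells.erase (i, ν.rowLen i - 1) : Set (ℕ × ℕ)) := by
      rintro ⟨a, b⟩ ⟨a', b'⟩ hle hab
      obtain ⟨h1, h2⟩ := Prod.mk_le_mk.1 hle
      simp only [Finset.mem_coe, mem_cells, Finset.mem_erase, ne_eq,
        Prod.mk.injEq, mem_iff_lt_rowLen] at hab ⊢
      have h3 := ν.rowLen_anti a' a h1
      refine ⟨?_, by omega⟩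
      rintro ⟨rfl, rfl⟩
      rcases h1.eq_or_lt with rfl | h1
      · omega
      · have := ν.rowLen_anti (a' + 1) a h1
        omega
    refine ⟨⟨_, hlow⟩, yCov_iff_exists_insert.2 ⟨(i, ν.rowLen i - 1), ?_, ?_⟩, rfl⟩
    · rw [← mem_cells]; simp
    · exact (Finset.insert_erase hmem).symm

theorem cells_injective : Function.Injective YoungDiagram.cells := fun _ _ => YoungDiagram.ext

theorem finite_setOf_yCov (μ : YoungDiagram) : {ν | YCov μ ν}.Finite :=
  Set.Finite.of_finite_image (image_cells_setOf_yCov μ ▸ Finset.finite_toSet _)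
    cells_injective.injOn

theorem finite_setOf_yCov_right (ν : YoungDiagram) : {μ | YCov μ ν}.Finite :=
  Set.Finite.of_finite_image (image_cells_setOf_yCov_right ν ▸ Finset.finite_toSet _)
    cells_injective.injOn

/-- The diagrams covering `μ` in Young's lattice. -/
noncomputable def upCovers (μ : YoungDiagram) : Finset YoungDiagram :=
  (finite_setOf_yCov μ).toFinset

/-- The diagrams covered by `μ` in Young's lattice. -/
noncomputable def downCovers (μ : YoungDiagram) : Finset YoungDiagram :=
  (finite_setOf_yCov_right μ).toFinset

theorem mem_upCovers {μ ν : YoungDiagram} : ν ∈ upCovers μ ↔ YCov μ ν := by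
  simp [upCovers]

theorem mem_downCovers {μ ν : YoungDiagram} : ν ∈ downCovers μ ↔ YCov ν μ := by
  simp [downCovers]

theorem card_upCovers_eq (μ : YoungDiagram) : (upCovers μ).card = μ.addableRows.card := by
  rw [upCovers, ← Set.ncard_eq_toFinset_card _ (finite_setOf_yCov μ),
    ← Set.ncard_image_of_injective _ cells_injective, image_cells_setOf_yCov,
    Set.ncard_coe_finset, Finset.card_image_of_injOn]
  intro i _ j _ h
  have h1 : (i, μ.rowLen i) ∈ insert (j, μ.rowLen j) μ.cells := by
    rw [← show _ = insert (j, μ.rowLen j) μ.cells from h]; simp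
  simp only [Finset.mem_insert, mem_cells, mem_iff_lt_rowLen, lt_irrefl, or_false,
    Prod.mk.injEq] at h1
  exact h1.1

theorem card_downCovers_eq (μ : YoungDiagram) : (downCovers μ).card = μ.removableRows.card := by
  rw [downCovers, ← Set.ncard_eq_toFinset_card _ (finite_setOf_yCov_right μ),
    ← Set.ncard_image_of_injective _ cells_injective, image_cells_setOf_yCov_right,
    Set.ncard_coe_finset, Finset.card_image_of_injOn]
  intro i hi j _ h
  rw [Finset.mem_coe, mem_removableRows] at hi
  by_contra hne
  have h1 : (i, μ.rowLen i - 1) ∈ μ.cells.erase (j, μ.rowLen j - 1) := by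
    rw [Finset.mem_erase, mem_cells, mem_iff_lt_rowLen, ne_eq, Prod.mk.injEq]
    omega
  rw [← show _ = μ.cells.erase (j, μ.rowLen j - 1) from h] at h1
  simp at h1

theorem card_upCovers (μ : YoungDiagram) : (upCovers μ).card = (downCovers μ).card + 1 := by
  rw [card_upCovers_eq, card_downCovers_eq, card_addableRows]

theorem YCov.sup_eq {lam μ ν : YoungDiagram} (h : YCov lam ν) (h' : YCov μ ν) (hne : μ ≠ lam) :
    lam ⊔ μ = ν := by
  refine eq_of_le_of_card_le (sup_le h.1 h'.1) ?_
  by_contra hlt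
  have h1 : lam = lam ⊔ μ := eq_of_le_of_card_le le_sup_left (by have := h.2; omega)
  exact hne (eq_of_le_of_card_le (h1 ▸ le_sup_right) (by have := h.2; have := h'.2; omega))

theorem YCov.inf_eq {lam μ κ : YoungDiagram} (h : YCov κ lam) (h' : YCov κ μ) (hne : μ ≠ lam) :
    lam ⊓ μ = κ := by
  refine (eq_of_le_of_card_le (le_inf h.1 h'.1) ?_).symm
  by_contra hlt
  have h1 : lam ⊓ μ = lam := eq_of_le_of_card_le inf_le_left (by have := h.2; omega)
  exact hne (eq_of_le_of_card_le (h1 ▸ inf_le_right) (by have := h.2; have := h'.2; omega)).symm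

open Classical in
/-- The two ways of moving from `lam` to another diagram of the same size, through a common
upper cover or through a common lower cover, agree. -/
theorem sum_upCovers_downCovers_erase (f : YoungDiagram → ℕ) (lam : YoungDiagram) :
    ∑ ν ∈ upCovers lam, ∑ μ ∈ (downCovers ν).filter (· ≠ lam), f μ =
      ∑ κ ∈ downCovers lam, ∑ μ ∈ (upCovers κ).filter (· ≠ lam), f μ := by
  rw [Finset.sum_sigma', Finset.sum_sigma']
  refine Finset.sum_bij' (fun p _ => ⟨lam ⊓ p.2, p.2⟩) (fun p _ => ⟨lam ⊔ p.2, p.2⟩)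
    ?_ ?_ ?_ ?_ fun _ _ => rfl
  · rintro ⟨ν, μ⟩ h
    simp only [Finset.mem_sigma, Finset.mem_filter, mem_upCovers, mem_downCovers] at h ⊢
    obtain ⟨h1, h2, hne⟩ := h
    have h3 := card_sup_add_card_inf lam μ
    rw [h1.sup_eq h2 hne] at h3
    have h4 := h1.2
    have h5 := h2.2
    exact ⟨⟨inf_le_left, by omega⟩, ⟨inf_le_right, by omega⟩, hne⟩
  · rintro ⟨κ, μ⟩ h
    simp only [Finset.mem_sigma, Finset.mem_filter, mem_upCovers, mem_downCovers] at h ⊢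
    obtain ⟨h1, h2, hne⟩ := h
    have h3 := card_sup_add_card_inf lam μ
    rw [h1.inf_eq h2 hne] at h3
    have h4 := h1.2
    have h5 := h2.2
    exact ⟨⟨le_sup_left, by omega⟩, ⟨le_sup_right, by omega⟩, hne⟩
  · rintro ⟨ν, μ⟩ h
    simp only [Finset.mem_sigma, Finset.mem_filter, mem_upCovers, mem_downCovers] at h
    simp [h.1.sup_eq h.2.1 h.2.2]
  · rintro ⟨κ, μ⟩ h
    simp only [Finset.mem_sigma, Finset.mem_filter, mem_upCovers, mem_downCovers] at h
    simp [h.1.inf_eq h.2.1 h.2.2]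

/-- Standard fillings of `μ`, as functions on `ℕ × ℕ` vanishing outside `μ`. -/
def standardFillings (μ : YoungDiagram) : Set (ℕ × ℕ → ℕ) :=
  {g | (∀ c, c ∉ μ → g c = 0) ∧ (∀ c ∈ μ, g c < μ.card) ∧
    Set.InjOn g μ.cells ∧ StrictMonoOn g μ.cells}

theorem strictMonoOn_of_row_col {μ : YoungDiagram} {g : ℕ × ℕ → ℕ}
    (hr : ∀ c ∈ μ, ∀ d ∈ μ, c.1 = d.1 → c.2 < d.2 → g c < g d)
    (hc : ∀ c ∈ μ, ∀ d ∈ μ, c.2 = d.2 → c.1 < d.1 → g c < g d) :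
    StrictMonoOn g μ.cells := by
  rintro ⟨a, b⟩ h1 ⟨a', b'⟩ h2 hlt
  rw [Finset.mem_coe, mem_cells] at h1 h2
  obtain ⟨ha, hb⟩ := Prod.mk_le_mk.1 hlt.le
  have h3 : (a, b') ∈ μ := μ.up_left_mem ha le_rfl h2
  rcases ha.eq_or_lt with rfl | ha
  · exact hr _ h1 _ h2 rfl (lt_of_le_of_ne hb fun h => hlt.ne (Prod.ext rfl h))
  · rcases hb.eq_or_lt with rfl | hb
    · exact hc _ h1 _ h2 rfl ha
    · exact (hr _ h1 _ h3 rfl hb).trans (hc _ h3 _ h2 rfl ha)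

/-- Extending a standard Young tableau by zero identifies the two notions of filling. -/
noncomputable def sytEquiv (μ : YoungDiagram) :
    {f : μ.cells → Fin μ.card //
      Function.Bijective f ∧
      (∀ a b : μ.cells, (a : ℕ × ℕ).1 = (b : ℕ × ℕ).1 → (a : ℕ × ℕ).2 < (b : ℕ × ℕ).2 →
        f a < f b) ∧
      (∀ a b : μ.cells, (a : ℕ × ℕ).2 = (b : ℕ × ℕ).2 → (a : ℕ × ℕ).1 < (b : ℕ × ℕ).1 →
        f a < f b)} ≃ standardFillings μ where
  toFun f := ⟨fun c => if h : c ∈ μ.cells then f.1 ⟨c, h⟩ else 0, by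
    obtain ⟨f, hf, hr, hc⟩ := f
    refine ⟨fun c h => dif_neg (by simpa using h), fun c h => ?_, fun c h d h' e => ?_,
      strictMonoOn_of_row_col (fun c h d h' e hlt => ?_) (fun c h d h' e hlt => ?_)⟩
    · rw [← mem_cells] at h
      simp only [h, dite_true]
      exact (f ⟨c, h⟩).2
    · rw [Finset.mem_coe] at h h'
      simp only [h, h', dite_true] at e
      exact congrArg Subtype.val (hf.1 (Fin.ext e))
    · rw [← mem_cells] at h h'
      simp only [h, h', dite_true]
      exact hr ⟨c, h⟩ ⟨d, h'⟩ e hlt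
    · rw [← mem_cells] at h h'
      simp only [h, h', dite_true]
      exact hc ⟨c, h⟩ ⟨d, h'⟩ e hlt⟩
  invFun g := ⟨fun c => ⟨g.1 c, g.2.2.1 c (by simp)⟩, by
    obtain ⟨g, -, hb, hi, hm⟩ := g
    refine ⟨(Fintype.bijective_iff_injective_and_card _).2 ⟨fun c d h => ?_, by simp⟩,
      fun c d h h' => ?_, fun c d h h' => ?_⟩
    · exact Subtype.ext (hi c.2 d.2 (Fin.mk.inj_iff.1 h))
    · exact hm c.2 d.2 (Prod.lt_iff.2 (Or.inr ⟨h.le, h'⟩))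
    · exact hm c.2 d.2 (Prod.lt_iff.2 (Or.inl ⟨h', h.le⟩))⟩
  left_inv f := by
    ext c
    simp
  right_inv g := by
    ext c
    by_cases h : c ∈ μ.cells
    · simp only [h, dite_true]
    · simp only [h, dite_false]
      exact (g.2.1 c (by simpa using h)).symm

theorem sytCount_eq_card_standardFillings (μ : YoungDiagram) :
    sytCount μ = Nat.card (standardFillings μ) :=
  Nat.card_congr (sytEquiv μ)

instance finite_standardFillings (μ : YoungDiagram) : Finite (standardFillings μ) :=
  Finite.of_equiv _ (sytEquiv μ)

open Classical in
/-- Extend a filling of `μ` to a diagram covering it by putting the largest entry in the new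
box. -/
theorem extend_mem_standardFillings {μ ν : YoungDiagram} (h : YCov μ ν) {g : ℕ × ℕ → ℕ}
    (hg : g ∈ standardFillings μ) :
    (fun c => if c ∈ ν ∧ c ∉ μ then μ.card else g c) ∈ standardFillings ν := by
  obtain ⟨h0, hb, hi, hm⟩ := hg
  obtain ⟨x, hx, hν⟩ := yCov_iff_exists_insert.1 h
  have hmem : ∀ d, d ∈ ν ↔ d = x ∨ d ∈ μ := fun d => by rw [← mem_cells, hν]; simp
  have hval : ∀ c, (if c ∈ ν ∧ c ∉ μ then μ.card else g c) = if c = x then μ.card else g c := by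
    intro c
    congr 1
    rw [hmem]
    grind
  simp only [hval]
  refine ⟨fun c hc => ?_, fun c hc => ?_, fun c hc d hd e => ?_, fun c hc d hd e => ?_⟩
  · rw [hmem] at hc
    push Not at hc
    exact (if_neg hc.1).trans (h0 c hc.2)
  · rw [h.2]
    rw [hmem] at hc
    have := hb c
    grind
  · rw [Finset.mem_coe, mem_cells, hmem] at hc hd
    have h1 := hb c
    have h2 := hb d
    have h3 := @hi c
    simp only [Finset.mem_coe, mem_cells] at h3
    grind
  · rw [Finset.mem_coe, mem_cells, hmem] at hc hd
    have h1 := hb c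
    have h2 := hb d
    have h3 := @hm c
    simp only [Finset.mem_coe, mem_cells] at h3
    have h4 : d ∈ μ → c ∈ μ := fun h => μ.isLowerSet e.le h
    have h5 := e.ne
    grind

open Classical in
/-- Every standard filling of `ν` arises by adding the largest entry to a standard filling of a
unique diagram covered by `ν`. -/
theorem bijective_extend (ν : YoungDiagram) (hν : ν.card ≠ 0) :
    Function.Bijective
      (fun p : (Σ μ : downCovers ν, standardFillings μ.1) =>
        (⟨fun c => if c ∈ ν ∧ c ∉ p.1.1 then p.1.1.card else p.2.1 c,
          extend_mem_standardFillings (mem_downCovers.1 p.1.2) p.2.2⟩ : standardFillings ν)) := by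
  constructor
  · rintro ⟨⟨μ, h⟩, g, hg⟩ ⟨⟨μ', h'⟩, g', hg'⟩ e
    rw [mem_downCovers] at h h'
    have hcard : μ.card = μ'.card := by have := h.2; have := h'.2; omega
    have e' := fun c => congrFun (congrArg Subtype.val e) c
    simp only at e'
    have hμ : μ = μ' := by
      refine YoungDiagram.ext (Finset.ext fun c => ?_)
      have h1 := hg.2.1 c
      have h2 := hg'.2.1 c
      have h3 := e' c
      have h4 : c ∈ μ → c ∈ ν := fun hc => h.1 hc
      have h5 : c ∈ μ' → c ∈ ν := fun hc => h'.1 hc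
      rw [mem_cells, mem_cells]
      grind
    subst hμ
    have hgg : g = g' := by
      funext c
      have h1 := hg.1 c
      have h2 := hg'.1 c
      have h3 := e' c
      grind
    subst hgg
    rfl
  · rintro ⟨g, h0, hb, hi, hm⟩
    obtain ⟨m, hm1⟩ := Nat.exists_eq_succ_of_ne_zero hν
    have himg : ν.cells.image g = range (m + 1) := by
      refine Finset.eq_of_subset_of_card_le (fun y hy => ?_) ?_
      · obtain ⟨c, hc, rfl⟩ := Finset.mem_image.1 hy
        have := hb c (by simpa using hc)
        rw [Finset.mem_range]
        omega
      · rw [Finset.card_image_of_injOn hi, Finset.card_range]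
        exact hm1.ge
    obtain ⟨x, hx, hxm⟩ := Finset.mem_image.1 (himg ▸ Finset.self_mem_range_succ m)
    have hlt : ∀ c ∈ ν.cells, c ≠ x → g c < m := fun c hc hne => by
      have h1 := hb c (by simpa using hc)
      have h2 : g c ≠ g x := fun h => hne (hi hc hx h)
      omega
    have hlow : IsLowerSet (ν.cells.erase x : Set (ℕ × ℕ)) := by
      intro c d hle hc
      rw [Finset.mem_coe, Finset.mem_erase] at hc ⊢
      have hd : d ∈ ν.cells := ν.isLowerSet hle hc.2
      refine ⟨?_, hd⟩
      rintro rfl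
      have h1 := hlt c hc.2 hc.1
      have h2 := hm hd hc.2 (lt_of_le_of_ne hle hc.1.symm)
      omega
    let μ : YoungDiagram := ⟨ν.cells.erase x, hlow⟩
    have hmem : ∀ c, c ∈ μ ↔ c ≠ x ∧ c ∈ ν := fun c => by
      rw [← mem_cells, Finset.mem_erase, mem_cells]
    have hcov : YCov μ ν := yCov_iff_exists_insert.2
      ⟨x, by simp [hmem], (Finset.insert_erase hx).symm⟩
    have hμm : μ.card = m := by have := hcov.2; omega
    rw [mem_cells] at hx
    refine ⟨⟨⟨μ, mem_downCovers.2 hcov⟩, fun c => if c = x then 0 else g c, ?_, ?_, ?_, ?_⟩, ?_⟩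
    · intro c hc
      have := h0 c
      grind
    · intro c hc
      have := hlt c
      simp only [mem_cells] at this
      grind
    · intro c hc d hd e
      rw [Finset.mem_coe, mem_cells, hmem] at hc hd
      simp only [hc.1, hd.1, if_false] at e
      exact hi (by simpa using hc.2) (by simpa using hd.2) e
    · intro c hc d hd e
      rw [Finset.mem_coe, mem_cells, hmem] at hc hd
      simp only [hc.1, hd.1, if_false]
      exact hm (by simpa using hc.2) (by simpa using hd.2) e
    · refine Subtype.ext (funext fun c => ?_)
      simp only [hmem]
      grind

theorem sytCount_eq_sum_downCovers {ν : YoungDiagram} (hν : ν.card ≠ 0) :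
    sytCount ν = ∑ μ ∈ downCovers ν, sytCount μ := by
  rw [sytCount_eq_card_standardFillings, ← Nat.card_eq_of_bijective _ (bijective_extend ν hν),
    Nat.card_sigma]
  simp only [sytCount_eq_card_standardFillings]
  exact Finset.sum_coe_sort (downCovers ν) fun μ => Nat.card (standardFillings μ)

theorem sytCount_bot : sytCount ⊥ = 1 := by
  rw [sytCount_eq_card_standardFillings, Nat.card_eq_one_iff_unique]
  refine ⟨⟨fun f g => Subtype.ext (funext fun c => ?_)⟩, ⟨fun _ => 0, ?_⟩⟩
  · rw [f.2.1 c (notMem_bot c), g.2.1 c (notMem_bot c)]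
  · exact ⟨fun _ _ => rfl, fun c hc => absurd hc (notMem_bot c), by simp, by simp [StrictMonoOn]⟩

open Classical in
theorem sum_upCovers_sytCount (lam : YoungDiagram) :
    ∑ ν ∈ upCovers lam, sytCount ν = (lam.card + 1) * sytCount lam := by
  induction hk : lam.card using Nat.strong_induction_on generalizing lam with
  | _ k ih =>
  have hsplit : ∀ s : Finset YoungDiagram, lam ∈ s →
      ∑ μ ∈ s, sytCount μ = sytCount lam + ∑ μ ∈ s.filter (· ≠ lam), sytCount μ := by
    intro s hs
    rw [Finset.filter_ne' s lam, Finset.add_sum_erase s _ hs]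
  have hup : ∑ ν ∈ upCovers lam, sytCount ν = (upCovers lam).card * sytCount lam +
      ∑ ν ∈ upCovers lam, ∑ μ ∈ (downCovers ν).filter (· ≠ lam), sytCount μ := by
    rw [← smul_eq_mul, ← Finset.sum_const, ← Finset.sum_add_distrib]
    refine Finset.sum_congr rfl fun ν hν => ?_
    rw [mem_upCovers] at hν
    rw [sytCount_eq_sum_downCovers (by have := hν.2; omega), hsplit _ (mem_downCovers.2 hν)]
  have hdown : ∑ κ ∈ downCovers lam, k * sytCount κ = (downCovers lam).card * sytCount lam +
      ∑ κ ∈ downCovers lam, ∑ μ ∈ (upCovers κ).filter (· ≠ lam), sytCount μ := by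
    rw [← smul_eq_mul, ← Finset.sum_const, ← Finset.sum_add_distrib]
    refine Finset.sum_congr rfl fun κ hκ => ?_
    rw [mem_downCovers] at hκ
    have h1 := hκ.2
    rw [← hsplit _ (mem_upCovers.2 hκ), ih κ.card (by omega) κ rfl, ← h1, hk]
  have hlam : ∑ κ ∈ downCovers lam, k * sytCount κ = k * sytCount lam := by
    rcases Nat.eq_zero_or_pos k with rfl | hpos
    · simp
    · rw [← Finset.mul_sum, ← sytCount_eq_sum_downCovers (by omega)]
  rw [sum_upCovers_downCovers_erase, card_upCovers] at hup
  linarith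

theorem disjoint_downCovers_upCovers (lam : YoungDiagram) :
    Disjoint (downCovers lam) (upCovers lam) := by
  refine Finset.disjoint_left.2 fun μ h h' => ?_
  have h1 := (mem_downCovers.1 h).2
  have h2 := (mem_upCovers.1 h').2
  omega

theorem IsOscTab.snoc {lam μ : YoungDiagram} {l : ℕ} {T : Fin (l + 1) → YoungDiagram}
    (hT : IsOscTab μ l T) (h : YCov μ lam ∨ YCov lam μ) :
    IsOscTab lam (l + 1) (Fin.snoc (α := fun _ => YoungDiagram) T lam) := by
  obtain ⟨h0, hl, hT⟩ := hT
  refine ⟨?_, Fin.snoc_last _ _, fun i => ?_⟩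
  · rw [← Fin.castSucc_zero, Fin.snoc_castSucc]
    exact h0
  · refine Fin.lastCases ?_ (fun i => ?_) i
    · rw [Fin.succ_last, Fin.snoc_last, Fin.snoc_castSucc, hl]
      exact h
    · rw [Fin.succ_castSucc, Fin.snoc_castSucc, Fin.snoc_castSucc]
      exact hT i

theorem mem_disjUnion_covers {lam μ : YoungDiagram} :
    μ ∈ (downCovers lam).disjUnion (upCovers lam) (disjoint_downCovers_upCovers lam) ↔
      YCov μ lam ∨ YCov lam μ := by
  rw [Finset.mem_disjUnion, mem_downCovers, mem_upCovers]

theorem sigma_oscTab_ext {s : Finset YoungDiagram} {l : ℕ} {p q : Σ μ : s, OscTab μ.1 l}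
    (h : p.2.1 = q.2.1) : p = q := by
  obtain ⟨⟨μ, hμ⟩, S, hS⟩ := p
  obtain ⟨⟨ν, hν⟩, T, hT⟩ := q
  obtain rfl : S = T := h
  obtain rfl : μ = ν := hS.2.1.symm.trans hT.2.1
  rfl

/-- Removing the last step of an oscillating tableau. -/
noncomputable def oscTabSuccEquiv (lam : YoungDiagram) (l : ℕ) :
    OscTab lam (l + 1) ≃
      Σ μ : (downCovers lam).disjUnion (upCovers lam) (disjoint_downCovers_upCovers lam),
        OscTab μ.1 l where
  toFun T := ⟨⟨T.1 (Fin.last l).castSucc, by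
      have h := T.2.2.2 (Fin.last l)
      rw [Fin.succ_last, T.2.2.1] at h
      exact mem_disjUnion_covers.2 h⟩,
    ⟨fun i => T.1 i.castSucc, by
      refine ⟨T.2.1, rfl, fun i => ?_⟩
      have h := T.2.2.2 i.castSucc
      rwa [Fin.succ_castSucc] at h⟩⟩
  invFun p := ⟨_, p.2.2.snoc (mem_disjUnion_covers.1 p.1.2)⟩
  left_inv T := by
    refine Subtype.ext (funext fun i => ?_)
    refine Fin.lastCases ?_ (fun i => ?_) i
    · exact (Fin.snoc_last (α := fun _ => YoungDiagram) _ _).trans T.2.2.1.symm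
    · exact Fin.snoc_castSucc (α := fun _ => YoungDiagram) _ _ _
  right_inv p := by
    exact sigma_oscTab_ext (funext fun i => Fin.snoc_castSucc (α := fun _ => YoungDiagram) _ _ _)

theorem subsingleton_oscTab_zero (lam : YoungDiagram) : Subsingleton (OscTab lam 0) := by
  refine ⟨fun S T => Subtype.ext (funext fun i => ?_)⟩
  obtain rfl : i = 0 := Fin.fin_one_eq_zero i
  exact S.2.1.trans T.2.1.symm

instance finite_oscTab (lam : YoungDiagram) (l : ℕ) : Finite (OscTab lam l) := by
  induction l generalizing lam with
  | zero =>
    have := subsingleton_oscTab_zero lam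
    infer_instance
  | succ l ih => exact Finite.of_equiv _ (oscTabSuccEquiv lam l).symm

theorem card_oscTab_succ (lam : YoungDiagram) (l : ℕ) :
    Nat.card (OscTab lam (l + 1)) =
      ∑ μ ∈ downCovers lam, Nat.card (OscTab μ l) +
        ∑ ν ∈ upCovers lam, Nat.card (OscTab ν l) := by
  rw [Nat.card_congr (oscTabSuccEquiv lam l), Nat.card_sigma,
    ← Finset.sum_disjUnion (disjoint_downCovers_upCovers lam)]
  exact Finset.sum_coe_sort _ fun μ => Nat.card (OscTab μ l)

theorem card_oscTab_bot_zero : Nat.card (OscTab ⊥ 0) = 1 :=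
  Nat.card_eq_one_iff_unique.2 ⟨subsingleton_oscTab_zero _, ⟨fun _ => ⊥, rfl, rfl, finZeroElim⟩⟩

theorem card_oscTab_eq_zero {lam : YoungDiagram} {l : ℕ} (h : l < lam.card) :
    Nat.card (OscTab lam l) = 0 := by
  induction l generalizing lam with
  | zero =>
    have : IsEmpty (OscTab lam 0) := ⟨fun T => by
      have h1 : lam = ⊥ := T.2.2.1.symm.trans T.2.1
      rw [h1, card_bot] at h
      exact h.false⟩
    exact Nat.card_of_isEmpty
  | succ l ih =>
    rw [card_oscTab_succ, Nat.add_eq_zero_iff]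
    constructor
    · refine Finset.sum_eq_zero fun μ hμ => ih ?_
      have := (mem_downCovers.1 hμ).2
      omega
    · refine Finset.sum_eq_zero fun ν hν => ih ?_
      have := (mem_upCovers.1 hν).2
      omega

theorem doubleFactorial_two_mul_succ_sub_one (m : ℕ) :
    Nat.doubleFactorial (2 * (m + 1) - 1) = (2 * m + 1) * Nat.doubleFactorial (2 * m - 1) := by
  rw [show 2 * (m + 1) - 1 = 2 * m + 1 by omega, Nat.doubleFactorial_add_one]

theorem choose_mul_doubleFactorial_rec (j m : ℕ) :
    (2 * (m + 1) + j).choose j * Nat.doubleFactorial (2 * (m + 1) - 1) +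
      (j + 2) * ((2 * m + (j + 2)).choose (j + 2) * Nat.doubleFactorial (2 * m - 1)) =
    (2 * (m + 1) + (j + 1)).choose (j + 1) * Nat.doubleFactorial (2 * (m + 1) - 1) := by
  have h := Nat.choose_succ_right_eq (2 * m + (j + 2)) (j + 1)
  rw [show 2 * m + (j + 2) - (j + 1) = 2 * m + 1 by omega] at h
  rw [doubleFactorial_two_mul_succ_sub_one, show 2 * (m + 1) + (j + 1) = (2 * m + (j + 2)) + 1 by ring, Nat.choose_succ_succ',
    show 2 * (m + 1) + j = 2 * m + (j + 2) by ring]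
  linear_combination Nat.doubleFactorial (2 * m - 1) * h

theorem downCovers_eq_empty {lam : YoungDiagram} (h : lam.card = 0) : downCovers lam = ∅ :=
  Finset.eq_empty_of_forall_notMem fun μ hμ => by
    have := (mem_downCovers.1 hμ).2
    omega

/-- **Theorem 1 (count of oscillating tableaux).**  If `|λ| = k` then for all `n`,
`#OT(λ, k + 2n) = C(2n + k, k) · (2n - 1)!! · f^λ`. -/
theorem count_oscillating_tableaux (lam : YoungDiagram) (k : ℕ) (hk : lam.card = k) (n : ℕ) :
    Nat.card (OscTab lam (k + 2 * n)) =
      (2 * n + k).choose k * Nat.doubleFactorial (2 * n - 1) * sytCount lam := by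
  induction hl : k + 2 * n generalizing lam k n with
  | zero =>
    obtain ⟨rfl, rfl⟩ : k = 0 ∧ n = 0 := by omega
    rw [eq_bot_of_card_eq_zero hk, card_oscTab_bot_zero, sytCount_bot]
    rfl
  | succ l ih =>
    rw [card_oscTab_succ]
    have hdown : ∀ j, k = j + 1 → ∑ μ ∈ downCovers lam, Nat.card (OscTab μ l) =
        (2 * n + j).choose j * Nat.doubleFactorial (2 * n - 1) * sytCount lam := by
      intro j hj
      rw [sytCount_eq_sum_downCovers (by omega), Finset.mul_sum]
      refine Finset.sum_congr rfl fun μ hμ => ?_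
      have := (mem_downCovers.1 hμ).2
      exact ih μ j (by omega) n (by omega)
    have hup : ∀ m, n = m + 1 → ∑ ν ∈ upCovers lam, Nat.card (OscTab ν l) =
        (2 * m + (k + 1)).choose (k + 1) * Nat.doubleFactorial (2 * m - 1) *
          ((k + 1) * sytCount lam) := by
      intro m hm
      rw [← hk, ← sum_upCovers_sytCount, Finset.mul_sum]
      refine Finset.sum_congr rfl fun ν hν => ?_
      have := (mem_upCovers.1 hν).2
      exact ih ν _ this m (by omega)
    cases n with
    | zero =>
      rw [hdown l (by omega), Finset.sum_eq_zero fun ν hν => ?_]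
      · simp
      · have := (mem_upCovers.1 hν).2
        exact card_oscTab_eq_zero (by omega)
    | succ m =>
      rw [hup m rfl]
      cases k with
      | zero =>
        rw [downCovers_eq_empty hk, doubleFactorial_two_mul_succ_sub_one]
        simp
      | succ j =>
        rw [hdown j rfl, ← choose_mul_doubleFactorial_rec]
        ring
end

section
/- For every perfect matching M of [2n], the number of alignments of M equals binom(n,2) minus the area of the Dyck path D_M, that is, al(M) = C(n,2) − area(D_M). -/
/-- `M` is a perfect matching of `{1, …, 2n}` (modeled on `Fin (2 * n)`):
a partition of the ground set into pairs. -/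
def IsPerfectMatching (n : ℕ) (M : Finset (Finset (Fin (2 * n)))) : Prop :=
  (∀ p ∈ M, p.card = 2) ∧ ∀ i : Fin (2 * n), ∃! p, p ∈ M ∧ i ∈ p

/-- The (ordered) pair of pairs `(p, q)` forms a crossing: `p = {a, b}`, `q = {c, d}` with
`a < c < b < d`.  Each unordered crossing `{p, q}` satisfies this in exactly one order. -/
def IsCrossing {m : ℕ} (p q : Finset (Fin m)) : Prop :=
  ∃ a b c d : Fin m, p = {a, b} ∧ q = {c, d} ∧ a < c ∧ c < b ∧ b < d

/-- `(p, q)` forms a nesting: `p = {a, b}`, `q = {c, d}` with `c < a < b < d`. -/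
def IsNesting {m : ℕ} (p q : Finset (Fin m)) : Prop :=
  ∃ a b c d : Fin m, p = {a, b} ∧ q = {c, d} ∧ c < a ∧ a < b ∧ b < d

/-- `(p, q)` forms an alignment: `p = {a, b}`, `q = {c, d}` with `a < b < c < d`. -/
def IsAlignment {m : ℕ} (p q : Finset (Fin m)) : Prop :=
  ∃ a b c d : Fin m, p = {a, b} ∧ q = {c, d} ∧ a < b ∧ b < c ∧ c < d

/-- `cr(M)`: the number of crossings of `M`. -/
noncomputable def crCount (n : ℕ) (M : Finset (Finset (Fin (2 * n)))) : ℕ :=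
  Nat.card {pq : Finset (Fin (2 * n)) × Finset (Fin (2 * n)) //
    pq.1 ∈ M ∧ pq.2 ∈ M ∧ IsCrossing pq.1 pq.2}

/-- `ne(M)`: the number of nestings of `M`. -/
noncomputable def neCount (n : ℕ) (M : Finset (Finset (Fin (2 * n)))) : ℕ :=
  Nat.card {pq : Finset (Fin (2 * n)) × Finset (Fin (2 * n)) //
    pq.1 ∈ M ∧ pq.2 ∈ M ∧ IsNesting pq.1 pq.2}

/-- `al(M)`: the number of alignments of `M`. -/
noncomputable def alCount (n : ℕ) (M : Finset (Finset (Fin (2 * n)))) : ℕ :=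
  Nat.card {pq : Finset (Fin (2 * n)) × Finset (Fin (2 * n)) //
    pq.1 ∈ M ∧ pq.2 ∈ M ∧ IsAlignment pq.1 pq.2}

/-- The Dyck word `D_M` of a matching `M`: the `i`-th letter is `true` (= 1) iff `i` is an
opener of `M` (the smaller element of its pair). -/
def matchDyck (n : ℕ) (M : Finset (Finset (Fin (2 * n)))) : Fin (2 * n) → Bool :=
  fun i => decide (∃ p ∈ M, i ∈ p ∧ ∃ j ∈ p, i < j)

/-- The area of the Dyck path of `w`: the number of complete unit boxes lying below the path
and above the diagonal.  The unit box with lower-left corner `(x, y)` is above the diagonal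
iff `y < x`, and lies below the path iff, at the moment the path takes its `(x+1)`-st up step
(i.e. at the index `j` with `w j = true` preceded by exactly `x` ones), at most `y` down
steps have already been taken. -/
noncomputable def dyckArea (n : ℕ) (w : Fin (2 * n) → Bool) : ℕ :=
  Nat.card {xy : ℕ × ℕ // xy.2 < xy.1 ∧ ∃ j : Fin (2 * n), w j = true ∧
    (Finset.univ.filter fun k : Fin (2 * n) => k < j ∧ w k = true).card = xy.1 ∧
    (Finset.univ.filter fun k : Fin (2 * n) => k < j ∧ w k = false).card ≤ xy.2}

theorem Finset.sum_card_filter_lt {α : Type*} [LinearOrder α] (s : Finset α) :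
    ∑ j ∈ s, (s.filter fun k => k < j).card = s.card.choose 2 := by
  induction s using Finset.induction_on_max with
  | empty => simp
  | insert a s ha ih =>
    have has : a ∉ s := fun h => lt_irrefl _ (ha a h)
    have h1 : (insert a s).filter (fun k => k < a) = s := by
      ext k
      simp only [Finset.mem_filter, Finset.mem_insert]
      constructor
      · rintro ⟨rfl | h, hk⟩
        · exact absurd hk (lt_irrefl _)
        · exact h
      · exact fun h => ⟨Or.inr h, ha k h⟩
    have h2 : ∀ j ∈ s, ((insert a s).filter fun k => k < j) = s.filter fun k => k < j := by
      intro j hj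
      rw [Finset.filter_insert, if_neg (not_lt.mpr (ha j hj).le)]
    rw [Finset.sum_insert has, h1, Finset.sum_congr rfl fun j hj => congrArg Finset.card (h2 j hj),
      ih, Finset.card_insert_of_notMem has, Nat.choose_succ_succ' s.card 1, Nat.choose_one_right]

/-- A perfect matching is given by a partner function `f`, whose Dyck word has its openers at
the `i` with `i < f i`. -/
theorem IsPerfectMatching.exists_partner {n : ℕ} {M : Finset (Finset (Fin (2 * n)))}
    (hM : IsPerfectMatching n M) :
    ∃ f : Fin (2 * n) → Fin (2 * n), (∀ i, f i ≠ i) ∧ (∀ i, f (f i) = i) ∧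
      (∀ i, {i, f i} ∈ M) ∧ (∀ i j, i ≠ j → {i, j} ∈ M → f i = j) ∧
      (∀ i, matchDyck n M i = true ↔ i < f i) := by
  have hex : ∀ i, ∃ j, j ≠ i ∧ ({i, j} : Finset (Fin (2 * n))) ∈ M := by
    intro i
    obtain ⟨p, ⟨hp, hip⟩, -⟩ := hM.2 i
    obtain ⟨x, y, hxy, rfl⟩ := Finset.card_eq_two.mp (hM.1 p hp)
    simp only [Finset.mem_insert, Finset.mem_singleton] at hip
    rcases hip with rfl | rfl
    · exact ⟨y, hxy.symm, hp⟩
    · exact ⟨x, hxy, by rwa [Finset.pair_comm]⟩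
  choose f hne hmem using hex
  have huniq : ∀ i p, p ∈ M → i ∈ p → p = {i, f i} := fun i p hp hip =>
    (hM.2 i).unique ⟨hp, hip⟩ ⟨hmem i, by simp⟩
  have hpair : ∀ i j, i ≠ j → {i, j} ∈ M → f i = j := by
    intro i j hij h
    have hj : j ∈ ({i, f i} : Finset (Fin (2 * n))) := huniq i _ h (by simp) ▸ by simp
    simp only [Finset.mem_insert, Finset.mem_singleton] at hj
    rcases hj with h | h
    · exact absurd h.symm hij
    · exact h.symm
  refine ⟨f, hne, fun i => hpair _ _ (hne i) (by rw [Finset.pair_comm]; exact hmem i), hmem,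
    hpair, fun i => ?_⟩
  simp only [matchDyck, decide_eq_true_eq]
  constructor
  · rintro ⟨p, hp, hip, j, hj, hij⟩
    rw [huniq i p hp hip] at hj
    simp only [Finset.mem_insert, Finset.mem_singleton] at hj
    rcases hj with rfl | rfl
    · exact absurd hij (lt_irrefl _)
    · exact hij
  · exact fun h => ⟨_, hmem i, by simp, f i, by simp, h⟩

/-- Alignments correspond to pairs consisting of a closer and a later opener. -/
theorem IsPerfectMatching.alCount_eq_sum {n : ℕ} {M : Finset (Finset (Fin (2 * n)))}
    (hM : IsPerfectMatching n M) :
    alCount n M = ∑ j with matchDyck n M j = true,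
      (Finset.univ.filter fun k => k < j ∧ matchDyck n M k = false).card := by
  obtain ⟨f, hne, hinv, hmem, hpair, hw⟩ := hM.exists_partner
  have hw' : ∀ i, matchDyck n M i = false ↔ f i < i := by
    intro i
    rw [← Bool.not_eq_true, hw, not_lt]
    exact (hne i).le_iff_lt
  rw [← Finset.card_sigma, ← Fintype.card_coe, ← Nat.card_eq_fintype_card, alCount]
  symm
  refine Nat.card_eq_of_bijective (fun x => ⟨({f x.1.2, x.1.2}, {x.1.1, f x.1.1}), ?_⟩) ⟨?_, ?_⟩
  · obtain ⟨⟨c, b⟩, h⟩ := x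
    simp only [Finset.mem_sigma, Finset.mem_filter, Finset.mem_univ, true_and, hw, hw'] at h
    refine ⟨?_, hmem c, f b, b, c, f c, rfl, rfl, h.2.2, h.2.1, h.1⟩
    rw [Finset.pair_comm]
    exact hmem b
  · rintro ⟨⟨c, b⟩, h⟩ ⟨⟨c', b'⟩, h'⟩ heq
    simp only [Finset.mem_sigma, Finset.mem_filter, Finset.mem_univ, true_and, hw, hw'] at h h'
    simp only [Subtype.mk.injEq, Prod.mk.injEq] at heq
    have hb : b' ∈ ({f b, b} : Finset (Fin (2 * n))) := heq.1 ▸ by simp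
    have hc : c' ∈ ({c, f c} : Finset (Fin (2 * n))) := heq.2 ▸ by simp
    simp only [Finset.mem_insert, Finset.mem_singleton] at hb hc
    have hb' : b' = b := by
      rcases hb with rfl | hb
      · rw [hinv] at h'
        exact absurd h'.2.2 h.2.2.asymm
      · exact hb
    have hc' : c' = c := by
      rcases hc with hc | rfl
      · exact hc
      · rw [hinv] at h'
        exact absurd h'.1 h.1.asymm
    subst hb' hc'
    rfl
  · rintro ⟨⟨p, q⟩, hp, hq, a, b, c, d, hpab, hqcd, hab, hbc, hcd⟩
    dsimp only at hp hq hpab hqcd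
    subst hpab hqcd
    have hfa : f b = a := hpair b a hab.ne' (by rw [Finset.pair_comm]; exact hp)
    have hfc : f c = d := hpair c d hcd.ne hq
    refine ⟨⟨⟨c, b⟩, ?_⟩, ?_⟩
    · simp only [Finset.mem_sigma, Finset.mem_filter, Finset.mem_univ, true_and, hw, hw']
      exact ⟨hfc ▸ hcd, hbc, hfa ▸ hab⟩
    · simp only [hfa, hfc]

/-- The area of a path is the sum over its up steps of the number of boxes in the column of
that step. -/
theorem dyckArea_eq_sum (n : ℕ) (w : Fin (2 * n) → Bool) :
    dyckArea n w = ∑ j with w j = true,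
      ((Finset.univ.filter fun k => k < j ∧ w k = true).card -
        (Finset.univ.filter fun k => k < j ∧ w k = false).card) := by
  set x : Fin (2 * n) → ℕ := fun j => (Finset.univ.filter fun k => k < j ∧ w k = true).card
  set y : Fin (2 * n) → ℕ := fun j => (Finset.univ.filter fun k => k < j ∧ w k = false).card
  have hlt : ∀ i j, w i = true → i < j → x i < x j := by
    intro i j hi hij
    refine Finset.card_lt_card (Finset.ssubset_iff_of_subset ?_ |>.mpr ⟨i, ?_, ?_⟩)
    · intro k hk
      simp only [Finset.mem_filter, Finset.mem_univ, true_and] at hk ⊢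
      exact ⟨hk.1.trans hij, hk.2⟩
    · simp [hij, hi]
    · simp
  have hinj : ∀ i j, w i = true → w j = true → x i = x j → i = j := by
    intro i j hi hj h
    rcases lt_trichotomy i j with hij | hij | hij
    · exact absurd h (hlt i j hi hij).ne
    · exact hij
    · exact absurd h (hlt j i hj hij).ne'
  change _ = ∑ j with w j = true, (x j - y j)
  simp only [← Nat.card_Ico]
  rw [← Finset.card_sigma, ← Fintype.card_coe, ← Nat.card_eq_fintype_card, dyckArea]
  symm
  refine Nat.card_eq_of_bijective (fun s => ⟨(x s.1.1, s.1.2), ?_⟩) ⟨?_, ?_⟩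
  · obtain ⟨⟨j, v⟩, h⟩ := s
    simp only [Finset.mem_sigma, Finset.mem_filter, Finset.mem_univ, true_and,
      Finset.mem_Ico] at h
    exact ⟨h.2.2, j, h.1, rfl, h.2.1⟩
  · rintro ⟨⟨j, v⟩, h⟩ ⟨⟨j', v'⟩, h'⟩ heq
    simp only [Finset.mem_sigma, Finset.mem_filter, Finset.mem_univ, true_and,
      Finset.mem_Ico] at h h'
    simp only [Subtype.mk.injEq, Prod.mk.injEq] at heq
    obtain rfl := hinj j j' h.1 h'.1 heq.1
    obtain rfl := heq.2
    rfl
  · rintro ⟨⟨u, v⟩, hvu, j, hj, hu, hv⟩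
    dsimp only at hvu hu hv
    subst hu
    refine ⟨⟨⟨j, v⟩, ?_⟩, rfl⟩
    simp only [Finset.mem_sigma, Finset.mem_filter, Finset.mem_univ, true_and, Finset.mem_Ico]
    exact ⟨hj, hv, hvu⟩

theorem IsPerfectMatching.card_closers_le_card_openers {n : ℕ}
    {M : Finset (Finset (Fin (2 * n)))} (hM : IsPerfectMatching n M) (j : Fin (2 * n)) :
    (Finset.univ.filter fun k => k < j ∧ matchDyck n M k = false).card ≤
      (Finset.univ.filter fun k => k < j ∧ matchDyck n M k = true).card := by
  obtain ⟨f, hne, hinv, -, -, hw⟩ := hM.exists_partner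
  refine Finset.card_le_card_of_injOn f ?_ (Function.LeftInverse.injective hinv).injOn
  intro k hk
  simp only [Finset.coe_filter, Finset.mem_univ, true_and, Set.mem_ofPred_eq] at hk ⊢
  rw [← Bool.not_eq_true, hw, not_lt, (hne k).le_iff_lt] at hk
  rw [hw, hinv]
  exact ⟨hk.2.trans hk.1, hk.2⟩

theorem IsPerfectMatching.card_openers {n : ℕ} {M : Finset (Finset (Fin (2 * n)))}
    (hM : IsPerfectMatching n M) :
    (Finset.univ.filter fun j => matchDyck n M j = true).card = n := by
  obtain ⟨f, hne, hinv, -, -, hw⟩ := hM.exists_partner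
  have hflip : (Finset.univ.filter fun j => matchDyck n M j = true).card =
      (Finset.univ.filter fun j => ¬ matchDyck n M j = true).card := by
    refine Finset.card_nbij' f f ?_ ?_ (fun i _ => hinv i) (fun i _ => hinv i)
    · intro i hi
      simp only [Finset.coe_filter, Finset.mem_univ, true_and, Set.mem_ofPred_eq, hw, hinv,
        not_lt] at hi ⊢
      exact hi.le
    · intro i hi
      simp only [Finset.coe_filter, Finset.mem_univ, true_and, Set.mem_ofPred_eq, hw, hinv,
        not_lt] at hi ⊢
      exact (hne i).lt_of_le hi
  have htotal := Finset.card_filter_add_card_filter_not (s := (Finset.univ : Finset (Fin (2 * n))))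
    (fun j => matchDyck n M j = true)
  rw [Finset.card_univ, Fintype.card_fin] at htotal
  omega

/-- **Proposition 5(a).**  For every perfect matching `M` of `[2n]`,
`al(M) = C(n, 2) - area(D_M)`. -/
theorem alignments_eq_choose_sub_area (n : ℕ) (M : Finset (Finset (Fin (2 * n))))
    (hM : IsPerfectMatching n M) :
    (alCount n M : ℤ) = (n.choose 2 : ℤ) - (dyckArea n (matchDyck n M) : ℤ) := by
  have hsum := Finset.sum_card_filter_lt (Finset.univ.filter fun j => matchDyck n M j = true)
  rw [hM.card_openers] at hsum
  simp only [Finset.filter_filter, and_comm (a := matchDyck n M _ = true)] at hsum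
  have hadd : alCount n M + dyckArea n (matchDyck n M) = n.choose 2 := by
    rw [hM.alCount_eq_sum, dyckArea_eq_sum, ← Finset.sum_add_distrib, ← hsum]
    exact Finset.sum_congr rfl fun j _ => Nat.add_sub_of_le (hM.card_closers_le_card_openers j)
  omega
end

section
/- Let n be a natural number, let M be a perfect matching of [2n], and let T be an oscillating tableau of shape ∅ and length 2n whose Dyck word D_T equals the Dyck word D_M of M. Then wt(T) = n + 2·(C(n,2) − al(M)). -/
/-- The weight of an oscillating tableau: the sum of the sizes of all partitions it visits. -/
def oscWt {lam : YoungDiagram} {l : ℕ} (T : OscTab lam l) : ℕ := ∑ i, (T.1 i).card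

/-- The Dyck word `D_T` of an oscillating tableau `T` of empty shape and length `2n`:
the `i`-th letter is `true` (= 1) iff the `i`-th step of `T` adds a box. -/
def tabDyck (n : ℕ) (T : OscTab ⊥ (2 * n)) : Fin (2 * n) → Bool :=
  fun i => decide ((T.1 i.castSucc).card < (T.1 i.succ).card)

theorem fin_last_eq_sum_of_succ {m : ℕ} (f : Fin (m + 1) → ℤ) (e : Fin m → ℤ) (h0 : f 0 = 0)
    (h : ∀ i, f i.succ = f i.castSucc + e i) : f (Fin.last m) = ∑ i, e i := by
  induction m with
  | zero => simpa using h0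
  | succ m ih =>
    have := ih (fun i => f i.castSucc) (fun i => e i.castSucc) h0 fun i => h i.castSucc
    rw [Fin.sum_univ_castSucc, ← this]
    exact h (Fin.last m)

theorem fin_sum_eq_sum_sub_mul_of_succ {m : ℕ} (f : Fin (m + 1) → ℤ) (e : Fin m → ℤ)
    (h0 : f 0 = 0) (h : ∀ i, f i.succ = f i.castSucc + e i) :
    ∑ i, f i = ∑ i : Fin m, ((m : ℤ) - (i : ℕ)) * e i := by
  induction m with
  | zero => simpa using h0
  | succ m ih =>
    have key := ih (fun i => f i.castSucc) (fun i => e i.castSucc) h0 fun i => h i.castSucc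
    rw [Fin.sum_univ_castSucc, key, fin_last_eq_sum_of_succ f e h0 h, Fin.sum_univ_castSucc,
      Fin.sum_univ_castSucc, ← add_assoc, ← Finset.sum_add_distrib]
    congr 1
    · refine Finset.sum_congr rfl fun i _ => ?_
      push_cast [Fin.val_castSucc]
      ring
    · simp

theorem sum_card_filter_lt_eq_choose_two {α : Type*} [LinearOrder α] (s : Finset α) :
    ∑ j ∈ s, (s.filter (· < j)).card = s.card.choose 2 := by
  induction s using Finset.induction_on_max with
  | empty => simp
  | insert a s ha ih =>
    have hna : a ∉ s := fun h => lt_irrefl a (ha a h)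
    rw [Finset.sum_insert hna, Finset.card_insert_of_notMem hna, Nat.choose_succ_succ' _ 1,
      Nat.choose_one_right, ← ih]
    congr 1
    · rw [Finset.filter_insert, if_neg (lt_irrefl a), Finset.filter_true_of_mem ha]
    · refine Finset.sum_congr rfl fun j hj => ?_
      rw [Finset.filter_insert, if_neg (ha j hj).not_gt]

/-- Counting the letters before each `true` of a word: those that are `true` contribute a binomial
coefficient. -/
theorem sum_val_true_eq {m : ℕ} (D : Fin m → Bool) :
    ∑ j with D j = true, (j : ℕ) = (Finset.univ.filter (D · = true)).card.choose 2 +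
      (Finset.univ.filter fun x : Fin m × Fin m => D x.1 = false ∧ D x.2 = true ∧ x.1 < x.2).card := by
  have hpairs : (Finset.univ.filter
      fun x : Fin m × Fin m => D x.1 = false ∧ D x.2 = true ∧ x.1 < x.2).card =
      ∑ j with D j = true, (Finset.univ.filter fun i => D i = false ∧ i < j).card := by
    rw [Finset.card_eq_sum_card_fiberwise (f := Prod.snd)
      (t := Finset.univ.filter (D · = true)) (fun x hx => by simp_all)]
    refine Finset.sum_congr rfl fun j hj => ?_
    refine Finset.card_bij (fun x _ => x.1) (by grind) ?_ ?_
    · rintro ⟨a, b⟩ hx ⟨c, d⟩ hy hxy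
      simp_all
    · intro i hi
      exact ⟨(i, j), by simp_all, rfl⟩
  rw [hpairs, ← sum_card_filter_lt_eq_choose_two, ← Finset.sum_add_distrib]
  refine Finset.sum_congr rfl fun j _ => ?_
  rw [Finset.filter_filter, ← Finset.card_union_of_disjoint]
  · rw [← Finset.filter_or]
    have : (Finset.univ.filter fun i => D i = true ∧ i < j ∨ D i = false ∧ i < j) =
        Finset.Iio j := by
      ext i
      cases hi : D i <;> simp [hi]
    rw [this, Fin.card_Iio]
  · rw [Finset.disjoint_filter]
    rintro i - ⟨h, -⟩ ⟨h', -⟩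
    simp [h] at h'

namespace IsPerfectMatching

variable {n : ℕ} {M : Finset (Finset (Fin (2 * n)))}

theorem eq_of_mem (hM : IsPerfectMatching n M) {p q : Finset (Fin (2 * n))} {i : Fin (2 * n)}
    (hp : p ∈ M) (hq : q ∈ M) (hip : i ∈ p) (hiq : i ∈ q) : p = q :=
  (hM.2 i).unique ⟨hp, hip⟩ ⟨hq, hiq⟩

theorem matchDyck_of_lt (hM : IsPerfectMatching n M) {a b : Fin (2 * n)} (h : {a, b} ∈ M)
    (hab : a < b) : matchDyck n M a = true ∧ matchDyck n M b = false := by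
  refine ⟨decide_eq_true ⟨_, h, by simp, b, by simp, hab⟩, decide_eq_false ?_⟩
  rintro ⟨p, hp, hbp, j, hj, hbj⟩
  obtain rfl := hM.eq_of_mem hp h hbp (by simp)
  rcases Finset.mem_insert.1 hj with rfl | hj
  · exact hab.asymm hbj
  · exact hbj.ne' (Finset.mem_singleton.1 hj)

theorem exists_opener (hM : IsPerfectMatching n M) {i : Fin (2 * n)}
    (hi : matchDyck n M i = true) : ∃ j, i < j ∧ {i, j} ∈ M := by
  obtain ⟨p, hp, hip, j, hj, hij⟩ := of_decide_eq_true hi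
  refine ⟨j, hij, ?_⟩
  rwa [Finset.eq_of_subset_of_card_le (s := {i, j}) (t := p)
    (by simp [Finset.insert_subset_iff, hip, hj]) (by rw [hM.1 p hp, Finset.card_pair hij.ne])]

theorem exists_closer (hM : IsPerfectMatching n M) {i : Fin (2 * n)}
    (hi : matchDyck n M i = false) : ∃ j, j < i ∧ {j, i} ∈ M := by
  obtain ⟨p, hp, hip⟩ := (hM.2 i).exists
  obtain ⟨a, b, hab, rfl⟩ := Finset.card_eq_two.1 (hM.1 p hp)
  wlog hlt : a < b generalizing a b
  · exact this b a hab.symm (by rwa [Finset.pair_comm]) (by rwa [Finset.pair_comm])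
      (hab.lt_or_gt.resolve_left hlt)
  rcases Finset.mem_insert.1 hip with rfl | h
  · simp [(hM.matchDyck_of_lt hp hlt).1] at hi
  · obtain rfl := Finset.mem_singleton.1 h
    exact ⟨a, hlt, hp⟩

theorem eq_of_pair_eq (hM : IsPerfectMatching n M) {a b c d : Fin (2 * n)} (h : {a, b} ∈ M)
    (hab : a < b) (hcd : c < d) (he : ({a, b} : Finset (Fin (2 * n))) = {c, d}) :
    a = c ∧ b = d := by
  have h1 := hM.matchDyck_of_lt h hab
  have h2 := hM.matchDyck_of_lt (he ▸ h) hcd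
  have ha : a ∈ ({c, d} : Finset _) := he ▸ by simp
  have hb : b ∈ ({c, d} : Finset _) := he ▸ by simp
  simp only [Finset.mem_insert, Finset.mem_singleton] at ha hb
  grind

/-- Alignments correspond to pairs consisting of a closer and a later opener. -/
theorem alCount_eq (hM : IsPerfectMatching n M) :
    alCount n M = (Finset.univ.filter fun x : Fin (2 * n) × Fin (2 * n) =>
      matchDyck n M x.1 = false ∧ matchDyck n M x.2 = true ∧ x.1 < x.2).card := by
  classical
  rw [alCount, Nat.card_eq_fintype_card, Fintype.card_subtype]
  choose! lo hlo hloM using fun i => hM.exists_closer (i := i)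
  choose! hi hhi hhiM using fun i => hM.exists_opener (i := i)
  symm
  refine Finset.card_bij (fun x _ => ({lo x.1, x.1}, {x.2, hi x.2})) ?_ ?_ ?_
  · rintro ⟨i, j⟩ hx
    obtain ⟨h1, h2, h3⟩ := (Finset.mem_filter.1 hx).2
    exact Finset.mem_filter.2 ⟨Finset.mem_univ _, hloM i h1, hhiM j h2, lo i, i, j, hi j, rfl, rfl,
      hlo i h1, h3, hhi j h2⟩
  · rintro ⟨i, j⟩ hx ⟨i', j'⟩ hx' he
    obtain ⟨h1, h2, -⟩ := (Finset.mem_filter.1 hx).2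
    obtain ⟨h1', h2', -⟩ := (Finset.mem_filter.1 hx').2
    obtain ⟨e1, e2⟩ := Prod.ext_iff.1 he
    exact Prod.ext (hM.eq_of_pair_eq (hloM i h1) (hlo i h1) (hlo i' h1') e1).2
      (hM.eq_of_pair_eq (hhiM j h2) (hhi j h2) (hhi j' h2') e2).1
  · rintro ⟨p, q⟩ hpq
    obtain ⟨hp, hq, a, b, c, d, rfl, rfl, hab, hbc, hcd⟩ := (Finset.mem_filter.1 hpq).2
    have hb := (hM.matchDyck_of_lt hp hab).2
    have hc := (hM.matchDyck_of_lt hq hcd).1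
    refine ⟨(b, c), Finset.mem_filter.2 ⟨Finset.mem_univ _, hb, hc, hbc⟩, Prod.ext ?_ ?_⟩
    · exact hM.eq_of_mem (i := b) (hloM b hb) hp (by simp) (by simp)
    · exact hM.eq_of_mem (i := c) (hhiM c hc) hq (by simp) (by simp)

end IsPerfectMatching

theorem card_succ_eq_add_tabDyck (n : ℕ) (T : OscTab ⊥ (2 * n)) (i : Fin (2 * n)) :
    ((T.1 i.succ).card : ℤ) =
      (T.1 i.castSucc).card + (2 * (if tabDyck n T i = true then 1 else 0) - 1) := by
  rcases T.2.2.2 i with h | h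
  · have : tabDyck n T i = true := decide_eq_true (by have := h.2; omega)
    rw [if_pos this, h.2]
    push_cast
    ring
  · have : tabDyck n T i = false := decide_eq_false (by have := h.2; omega)
    rw [if_neg (by simp [this]), h.2]
    push_cast
    ring

theorem sum_step_tabDyck_eq_zero (n : ℕ) (T : OscTab ⊥ (2 * n)) :
    ∑ i, (2 * (if tabDyck n T i = true then 1 else 0) - 1 : ℤ) = 0 := by
  rw [← fin_last_eq_sum_of_succ (fun i => ((T.1 i).card : ℤ)) _ (by simp [T.2.1])
    (card_succ_eq_add_tabDyck n T)]
  simp [T.2.2.1]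

theorem card_true_tabDyck (n : ℕ) (T : OscTab ⊥ (2 * n)) :
    (Finset.univ.filter (tabDyck n T · = true)).card = n := by
  have h := sum_step_tabDyck_eq_zero n T
  rw [Finset.sum_sub_distrib, ← Finset.mul_sum, Finset.sum_boole, Finset.sum_const,
    Finset.card_univ, Fintype.card_fin, nsmul_one] at h
  push_cast at h
  omega

theorem oscWt_eq_sub (n : ℕ) (T : OscTab ⊥ (2 * n)) :
    (oscWt T : ℤ) = n * (2 * n - 1) - 2 * ∑ j with tabDyck n T j = true, ((j : ℕ) : ℤ) := by
  have h := fin_sum_eq_sum_sub_mul_of_succ (fun i => ((T.1 i).card : ℤ)) _ (by simp [T.2.1])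
    (card_succ_eq_add_tabDyck n T)
  have hall : (∑ i : Fin (2 * n), ((i : ℕ) : ℤ)) = n * (2 * n - 1) := by
    rw [Fin.sum_univ_eq_sum_range (fun i => (i : ℤ))]
    clear h T
    induction n with
    | zero => simp
    | succ n ih =>
      rw [Nat.mul_succ, Finset.sum_range_succ, Finset.sum_range_succ, ih]
      push_cast
      ring
  rw [oscWt, Nat.cast_sum, h, Finset.sum_filter, ← hall]
  simp only [sub_mul]
  rw [Finset.sum_sub_distrib, ← Finset.mul_sum, sum_step_tabDyck_eq_zero, mul_zero, zero_sub, Finset.mul_sum,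
    ← Finset.sum_neg_distrib, ← Finset.sum_sub_distrib]
  refine Finset.sum_congr rfl fun i _ => ?_
  split_ifs <;> ring

/-- **Proposition 5, conclusion.**  If `M` is a perfect matching of `[2n]` and `T` is an
oscillating tableau of shape `∅` and length `2n` with `D_T = D_M`, then
`wt(T) = n + 2·(C(n, 2) - al(M))`. -/
theorem weight_eq_of_dyck_eq (n : ℕ) (M : Finset (Finset (Fin (2 * n))))
    (hM : IsPerfectMatching n M) (T : OscTab ⊥ (2 * n))
    (hD : tabDyck n T = matchDyck n M) :
    (oscWt T : ℤ) = n + 2 * ((n.choose 2 : ℤ) - (alCount n M : ℤ)) := by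
  have hsum := congrArg (Nat.cast : ℕ → ℤ) (sum_val_true_eq (tabDyck n T))
  rw [card_true_tabDyck, hD, ← hM.alCount_eq, ← hD] at hsum
  push_cast at hsum
  have hchoose : ((n.choose 2 : ℕ) : ℤ) * 2 = n * (n - 1) := by
    have h := Finset.sum_range_id_mul_two n
    rw [Finset.sum_range_id, ← Nat.choose_two_right] at h
    cases n with
    | zero => simp
    | succ k =>
      rw [Nat.add_sub_cancel] at h
      push_cast
      rw [add_sub_cancel_right]
      exact_mod_cast h
  rw [oscWt_eq_sub, hsum]
  linear_combination -2 * hchoose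
end

section
/- For every perfect matching M of [2n], cr(M) + ne(M) = Σ_{i=1}^{n} a_i(D_M), where a_i(D) denotes the height statistic of the Dyck word D at its i-th zero. -/
/-- `b_i(w)`: the number of ones minus the number of zeros among the first `i` letters of `w`
(letters are indexed `0, …, 2n - 1`, so the first `i` letters sit at indices `< i`). -/
def dyckB (n : ℕ) (w : Fin (2 * n) → Bool) (i : ℕ) : ℤ :=
  ((Finset.univ.filter fun j : Fin (2 * n) => (j : ℕ) < i ∧ w j = true).card : ℤ) -
  ((Finset.univ.filter fun j : Fin (2 * n) => (j : ℕ) < i ∧ w j = false).card : ℤ)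

/-- `a_i(w) := b_j(w)` where `j` is the (1-indexed) position of the `i`-th zero of `w`
(an index `j₀` is the `i`-th zero iff exactly `i` zeros occur at indices `≤ j₀`;
the corresponding 1-indexed position is `j₀ + 1`).  If `w` has no `i`-th zero, `a_i(w) = 0`. -/
def dyckA (n : ℕ) (w : Fin (2 * n) → Bool) (i : ℕ) : ℤ :=
  ∑ j : Fin (2 * n),
    if w j = false ∧
        (Finset.univ.filter fun k : Fin (2 * n) => (k : ℕ) ≤ (j : ℕ) ∧ w k = false).card = i then
      dyckB n w ((j : ℕ) + 1)
    else 0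

open Finset

namespace IsPerfectMatching

variable {n : ℕ} {M : Finset (Finset (Fin (2 * n)))}

/-- A perfect matching is given by a fixed-point-free involution, sending each point to its
partner. -/
theorem exists_partner_s10 (hM : IsPerfectMatching n M) :
    ∃ σ : Fin (2 * n) → Fin (2 * n), (∀ i, σ i ≠ i) ∧ (∀ i, σ (σ i) = i) ∧
      ∀ p i, p ∈ M ∧ i ∈ p ↔ p = {i, σ i} := by
  obtain ⟨hcard, hM⟩ := hM
  have key : ∀ i, ∃ j, j ≠ i ∧ {i, j} ∈ M := by
    intro i
    obtain ⟨p, ⟨hp, hi⟩, -⟩ := hM i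
    obtain ⟨x, y, hxy, rfl⟩ := card_eq_two.1 (hcard p hp)
    rcases mem_insert.1 hi with rfl | hi
    · exact ⟨y, hxy.symm, hp⟩
    · obtain rfl := mem_singleton.1 hi
      exact ⟨x, hxy, by rwa [pair_comm]⟩
  choose σ hne hmem using key
  have huniq : ∀ p i, p ∈ M → i ∈ p → p = {i, σ i} := fun p i hp hi =>
    (hM i).unique ⟨hp, hi⟩ ⟨hmem i, by simp⟩
  refine ⟨σ, hne, fun i => ?_, fun p i => ⟨fun h => huniq p i h.1 h.2, ?_⟩⟩
  · have h := huniq {i, σ i} (σ i) (hmem i) (by simp)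
    have hi : i ∈ ({σ i, σ (σ i)} : Finset (Fin (2 * n))) := h ▸ by simp
    rcases mem_insert.1 hi with hi | hi
    · exact absurd hi.symm (hne i)
    · exact (mem_singleton.1 hi).symm
  · rintro rfl
    exact ⟨hmem i, by simp⟩

end IsPerfectMatching

section Involution

variable {m : ℕ} {σ : Fin m → Fin m}

theorem card_closers_filter_eq (hinv : ∀ i, σ (σ i) = i) (P : Fin m → Prop) [DecidablePred P] :
    #{j | P j ∧ σ j < j} = #{c | P (σ c) ∧ c < σ c} := by
  refine card_nbij' σ σ ?_ ?_ ?_ ?_ <;> intro i <;> simp [hinv]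

theorem two_mul_card_closers (hne : ∀ i, σ i ≠ i) (hinv : ∀ i, σ (σ i) = i) :
    2 * #{j | σ j < j} = m := by
  have h := card_filter_add_card_filter_not (s := (univ : Finset (Fin m))) (fun j => σ j < j)
  have h2 := card_closers_filter_eq hinv (fun _ => True)
  simp only [true_and] at h2
  have h3 : #{j | ¬ σ j < j} = #{j | j < σ j} := by
    congr 1
    ext j
    have := hne j
    grind
  simp at h
  simp at h3
  omega

theorem card_openers_sub_card_closers (hinv : ∀ i, σ (σ i) = i) {b : Fin m} (hb : σ b < b) :
    (#{j : Fin m | j ≤ b ∧ j < σ j} : ℤ) - #{j : Fin m | j ≤ b ∧ σ j < j} =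
      #{c : Fin m | c < b ∧ b < σ c} := by
  rw [card_closers_filter_eq hinv (· ≤ b)]
  have h := card_filter_add_card_filter_not (s := ({j | j ≤ b ∧ j < σ j} : Finset (Fin m)))
    (fun j => σ j ≤ b)
  simp only [filter_filter] at h
  have h1 : #{j | (j ≤ b ∧ j < σ j) ∧ σ j ≤ b} = #{c | σ c ≤ b ∧ c < σ c} := by
    congr 1; ext j; grind
  have h2 : #{j | (j ≤ b ∧ j < σ j) ∧ ¬ σ j ≤ b} = #{c | c < b ∧ b < σ c} := by
    congr 1; ext j
    have : j = b → σ j = σ b := fun h => h ▸ rfl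
    simp
    grind
  omega

theorem pair_eq_pair_of_lt {a b c d : Fin m} (hab : a < b) (hcd : c < d)
    (h : ({a, b} : Finset (Fin m)) = {c, d}) : a = c ∧ b = d := by
  have h1 : a ∈ ({c, d} : Finset (Fin m)) := h ▸ by simp
  have h2 : b ∈ ({c, d} : Finset (Fin m)) := h ▸ by simp
  simp only [mem_insert, mem_singleton] at h1 h2
  grind

theorem injOn_pairs :
    Set.InjOn (fun x : Fin m × Fin m =>
      (({σ x.1, x.1}, {x.2, σ x.2}) : Finset (Fin m) × Finset (Fin m)))
      {x | σ x.1 < x.1 ∧ x.2 < σ x.2} := by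
  rintro ⟨b, c⟩ ⟨hb, hc⟩ ⟨b', c'⟩ ⟨hb', hc'⟩ h
  simp only [Prod.mk.injEq] at h
  exact Prod.ext (pair_eq_pair_of_lt hb hb' h.1).2 (pair_eq_pair_of_lt hc hc' h.2).1

theorem natCard_eq_card_of_pairs {P : Finset (Fin m) × Finset (Fin m) → Prop}
    {Q : Fin m × Fin m → Prop} [DecidablePred Q]
    (hQ : ∀ x, Q x → σ x.1 < x.1 ∧ x.2 < σ x.2)
    (hP : ∀ y, P y ↔ ∃ x, Q x ∧ (({σ x.1, x.1}, {x.2, σ x.2}) : _ × _) = y) :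
    Nat.card {y // P y} = #{x | Q x} := by
  have h := ((injOn_pairs (σ := σ)).mono (s₁ := {x | Q x}) hQ).ncard_image
  rw [← Set.ncard_coe_finset, coe_filter_univ, ← h]
  change Set.ncard {y | P y} = _
  congr 1
  ext y
  exact hP y

end Involution

namespace IsPerfectMatching

variable {n : ℕ} {M : Finset (Finset (Fin (2 * n)))} {σ : Fin (2 * n) → Fin (2 * n)}

theorem partner_eq_of_pair_mem (hne : ∀ i, σ i ≠ i)
    (hσ : ∀ p i, p ∈ M ∧ i ∈ p ↔ p = {i, σ i}) {i j : Fin (2 * n)} (h : {i, j} ∈ M) (hij : i ≠ j) :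
    σ i = j ∧ σ j = i := by
  have aux : ∀ i j : Fin (2 * n), {i, j} ∈ M → i ≠ j → σ i = j := by
    intro i j h hij
    have h1 := (hσ _ i).1 ⟨h, by simp⟩
    have h2 : σ i ∈ ({i, j} : Finset (Fin (2 * n))) := h1 ▸ by simp
    simpa [hne i] using h2
  exact ⟨aux i j h hij, aux j i (by rwa [pair_comm]) hij.symm⟩

theorem crCount_eq (hne : ∀ i, σ i ≠ i) (hσ : ∀ p i, p ∈ M ∧ i ∈ p ↔ p = {i, σ i}) :
    crCount n M = #{x : Fin (2 * n) × Fin (2 * n) | σ x.1 < x.2 ∧ x.2 < x.1 ∧ x.1 < σ x.2} := by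
  refine natCard_eq_card_of_pairs (σ := σ) (fun x hx => by grind) ?_
  rintro ⟨p, q⟩
  constructor
  · rintro ⟨hp, hq, a, b, c, d, rfl, rfl, hac, hcb, hbd⟩
    obtain ⟨-, h1⟩ := partner_eq_of_pair_mem hne hσ hp (hac.trans hcb).ne
    obtain ⟨h2, -⟩ := partner_eq_of_pair_mem hne hσ hq (hcb.trans hbd).ne
    exact ⟨(b, c), by simp [*]⟩
  · rintro ⟨⟨b, c⟩, ⟨h1, h2, h3⟩, h⟩
    obtain ⟨rfl, rfl⟩ := Prod.mk.inj h
    exact ⟨((hσ _ b).2 (pair_comm _ _)).1, ((hσ _ c).2 rfl).1, _, _, _, _, rfl, rfl, h1, h2, h3⟩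

theorem neCount_eq (hne : ∀ i, σ i ≠ i) (hσ : ∀ p i, p ∈ M ∧ i ∈ p ↔ p = {i, σ i}) :
    neCount n M = #{x : Fin (2 * n) × Fin (2 * n) | x.2 < σ x.1 ∧ σ x.1 < x.1 ∧ x.1 < σ x.2} := by
  refine natCard_eq_card_of_pairs (σ := σ) (fun x hx => by grind) ?_
  rintro ⟨p, q⟩
  constructor
  · rintro ⟨hp, hq, a, b, c, d, rfl, rfl, hca, hab, hbd⟩
    obtain ⟨-, h1⟩ := partner_eq_of_pair_mem hne hσ hp hab.ne
    obtain ⟨h2, -⟩ := partner_eq_of_pair_mem hne hσ hq (hca.trans (hab.trans hbd)).ne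
    exact ⟨(b, c), by simp [*]⟩
  · rintro ⟨⟨b, c⟩, ⟨h1, h2, h3⟩, h⟩
    obtain ⟨rfl, rfl⟩ := Prod.mk.inj h
    exact ⟨((hσ _ b).2 (pair_comm _ _)).1, ((hσ _ c).2 rfl).1, _, _, _, _, rfl, rfl, h1, h2, h3⟩

theorem crCount_add_neCount (hne : ∀ i, σ i ≠ i) (hinv : ∀ i, σ (σ i) = i)
    (hσ : ∀ p i, p ∈ M ∧ i ∈ p ↔ p = {i, σ i}) :
    crCount n M + neCount n M = ∑ b with σ b < b, #{c | c < b ∧ b < σ c} := by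
  rw [crCount_eq hne hσ, neCount_eq hne hσ, ← card_union_of_disjoint, ← card_sigma]
  · refine card_nbij' (fun x => ⟨x.1, x.2⟩) (fun x => (x.1, x.2)) ?_ ?_ ?_ ?_
    · rintro ⟨b, c⟩
      simp
      grind
    · rintro ⟨b, c⟩
      have : c = σ b → σ c = b := fun h => h ▸ hinv b
      simp
      grind
    · exact fun _ _ => rfl
    · exact fun _ _ => rfl
  · rw [disjoint_filter]
    rintro ⟨b, c⟩ - h1 h2
    exact lt_asymm h1.1 h2.1

theorem matchDyck_eq_true_iff (hσ : ∀ p i, p ∈ M ∧ i ∈ p ↔ p = {i, σ i}) (i : Fin (2 * n)) :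
    matchDyck n M i = true ↔ i < σ i := by
  simp only [matchDyck, decide_eq_true_eq]
  constructor
  · rintro ⟨p, hp, hi, j, hj, hij⟩
    rw [(hσ p i).1 ⟨hp, hi⟩] at hj
    simp only [mem_insert, mem_singleton] at hj
    grind
  · intro h
    exact ⟨{i, σ i}, ((hσ _ i).2 rfl).1, by simp, σ i, by simp, h⟩

end IsPerfectMatching

/-- Summing `a_i` over `i ≤ k` is summing the height over all zeros of the word, provided there
are at most `k` of them. -/
theorem sum_dyckA {n k : ℕ} {w : Fin (2 * n) → Bool} (hk : #{j | w j = false} ≤ k) :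
    ∑ i ∈ Icc 1 k, dyckA n w i = ∑ j with w j = false, dyckB n w (j + 1) := by
  simp only [dyckA]
  rw [sum_comm, sum_filter]
  refine sum_congr rfl fun j _ => ?_
  by_cases hj : w j = false
  · have h1 : 1 ≤ #{k : Fin (2 * n) | (k : ℕ) ≤ j ∧ w k = false} :=
      card_pos.2 ⟨j, by simp [hj]⟩
    have h2 : #{k : Fin (2 * n) | (k : ℕ) ≤ j ∧ w k = false} ≤ k :=
      (card_le_card (monotone_filter_right _ fun _ _ h => h.2)).trans hk
    simp only [hj, true_and, if_true]
    rw [sum_ite_eq, if_pos (mem_Icc.2 ⟨h1, h2⟩)]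
  · simp [hj]

/-- For every perfect matching `M` of `[2n]`, `cr(M) + ne(M) = Σ_{i=1}^{n} a_i(D_M)`. -/
theorem crossings_add_nestings_eq_sum_a (n : ℕ) (M : Finset (Finset (Fin (2 * n))))
    (hM : IsPerfectMatching n M) :
    (crCount n M : ℤ) + (neCount n M : ℤ) = ∑ i ∈ Finset.Icc 1 n, dyckA n (matchDyck n M) i := by
  obtain ⟨σ, hne, hinv, hσ⟩ := hM.exists_partner_s10
  have htrue := IsPerfectMatching.matchDyck_eq_true_iff hσ
  have hfalse : ∀ i, matchDyck n M i = false ↔ σ i < i := by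
    intro i
    rw [← Bool.not_eq_true, htrue, not_lt, le_iff_lt_or_eq, or_iff_left (hne i)]
  have htwo := two_mul_card_closers hne hinv
  rw [sum_dyckA (by simp only [hfalse]; omega), ← Nat.cast_add,
    IsPerfectMatching.crCount_add_neCount hne hinv hσ, Nat.cast_sum]
  simp only [hfalse]
  refine sum_congr rfl fun b hb => ?_
  rw [← card_openers_sub_card_closers hinv (mem_filter.1 hb).2]
  simp only [dyckB, htrue, hfalse, Nat.lt_succ_iff, Fin.val_fin_le]
end
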